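/- arXiv:1012.4456 — 10 statements merged into one kernel-verified Lean document; each statement's English description precedes it below -/
import Mathlib

section
/- Suppose a structure tuple over K is admissible and definite (i.e. it satisfies equations (i)–(xxiv) and the definiteness condition (xxv)). Then there exist scalars muC, nuC, muD, nuD, cz, cw, dz, dw, c1, d1 in K such that cCz = muC*cz, cDz = nuC*cz, cCw = muC*cw, cDw = nuC*cw, dCz = muD*dz, dDz = nuD*dz, dCw = muD*dw, dDw = nuD*dw, c1C = nuC*c1, c1D = -muC*c1, d1C = nuD*d1, d1D = -muD*d1, and, setting Delta := nuC*muD - muC*nuD, one has Delta*(dz*c1 - cz*d1) = 1 and Delta*(dw*c1 - cw*d1) = 1 (in particular Delta ≠ 0), and moreover (cz - cw)*(dz - dw) ≠ 0 or c1*d1 ≠ 0. (This is the parameterization of planed LRT Lie supergroup structures for gl_K(1|1) in Theorem 2.5 of the paper, existence direction.) -/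
/-- A structure tuple of the 16 structural constants of a candidate planed LRT Lie
supergroup structure for `gl_K(1|1)` is *admissible* if it satisfies the 24
structural equations (i)–(xxiv). -/
def Admissible {K : Type*} [RCLike K]
    (cCz cCw cDz cDw dCz dCw dDz dDw c1C c1D cwC cwD d1C d1D dwC dwD : K) : Prop :=
  2*cCz*cDw - 2*cCz*cDz + cCz*cwC + cDz*cwD = 0 ∧
  cCz*c1C + cDz*c1D = 0 ∧
  2*cCw*cDw - 2*cCw*cDz + cCw*cwC + cDw*cwD = 0 ∧
  cCw*c1C + cDw*c1D = 0 ∧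
  cwC*c1C = 0 ∧
  cwC*c1D = 0 ∧
  2*cCz*c1D - 2*cCw*c1D - cwD*c1D = 0 ∧
  2*cDz*c1D - 2*cDw*c1D + cwD*c1C = 0 ∧
  2*dDz*dCw - 2*dDz*dCz + dCz*dwC + dDz*dwD = 0 ∧
  dCz*d1C + dDz*d1D = 0 ∧
  2*dDw*dCw - 2*dDw*dCz + dCw*dwC + dDw*dwD = 0 ∧
  dCw*d1C + dDw*d1D = 0 ∧
  2*dCw*d1C - 2*dCz*d1C - dwC*d1D = 0 ∧
  2*dDw*d1C - 2*dDz*d1C + dwC*d1C = 0 ∧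
  dwD*d1C = 0 ∧
  dwD*d1D = 0 ∧
  cwC*dCz + (cwD + 2*cCw - 4*cCz)*dDz + 2*cCz*dDw + cCz*dwC + cDz*dwD = 0 ∧
  -2*cCw*dDz + cwC*dCw + (cwD - 2*cCz + 4*cCw)*dDw + cCw*dwC + cDw*dwD = 0 ∧
  c1C*dCz + c1D*dDz + cCz*d1C + cDz*d1D = 1 ∧
  c1C*dCw + c1D*dDw + cCw*d1C + cDw*d1D = 1 ∧
  (2*cCw - 2*cCz)*d1C - cwC*d1D - c1D*dwC = 0 ∧
  (2*cDw - 2*cDz + cwC)*d1C + c1C*dwC = 0 ∧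
  (2*dCz - 2*dCw - dwD)*c1D - d1D*cwD = 0 ∧
  dwD*c1C + (2*dDz - 2*dDw)*c1D + d1C*cwD = 0

/-- A structure tuple is *definite* if it satisfies the definiteness condition (xxv). -/
def Definite {K : Type*} [RCLike K]
    (cCz cCw cDz cDw dCz dCw dDz dDw c1C c1D cwC cwD d1C d1D dwC dwD : K) : Prop :=
  ((cDw - cDz + cwC)*(dCw - dCz + dwD) - (cCw - cCz + cwD)*(dDw - dDz + dwC) ≠ 0) ∨
  (c1C*d1D - c1D*d1C ≠ 0)

/-- A vector orthogonal to a nonzero vector `(x, y)` of the plane is a multiple of `(-y, x)`. -/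
lemma exists_eq_mul_of_orthogonal {K : Type*} [Field K] {a b x y : K}
    (h : a * x + b * y = 0) (hxy : x ≠ 0 ∨ y ≠ 0) : ∃ t, a = -y * t ∧ b = x * t := by
  rcases hxy with hx | hy
  · refine ⟨b / x, ?_, ?_⟩ <;> field_simp
    linear_combination h
  · refine ⟨-a / y, ?_, ?_⟩ <;> field_simp
    linear_combination h

/-- Two vectors of the plane orthogonal to the same nonzero vector are linearly dependent. -/
lemma mul_sub_mul_eq_zero_of_orthogonal {K : Type*} [Field K] {a b a' b' x y : K}
    (h : a * x + b * y = 0) (h' : a' * x + b' * y = 0) (hxy : x ≠ 0 ∨ y ≠ 0) :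
    a * b' - b * a' = 0 := by
  obtain ⟨t, rfl, rfl⟩ := exists_eq_mul_of_orthogonal h hxy
  obtain ⟨t', rfl, rfl⟩ := exists_eq_mul_of_orthogonal h' hxy
  ring

/-- In a definite admissible tuple the vector `(d1C, d1D)` is nonzero. -/
lemma Admissible.d1_ne_zero {K : Type*} [RCLike K]
    {cCz cCw cDz cDw dCz dCw dDz dDw c1C c1D cwC cwD d1C d1D dwC dwD : K}
    (hadm : Admissible cCz cCw cDz cDw dCz dCw dDz dDw c1C c1D cwC cwD d1C d1D dwC dwD)
    (hdef : Definite cCz cCw cDz cDw dCz dCw dDz dDw c1C c1D cwC cwD d1C d1D dwC dwD) :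
    d1C ≠ 0 ∨ d1D ≠ 0 := by
  obtain ⟨-, h2, -, h4, h5, h6, h7, h8, -, -, -, -, -, -, -, -, -, -, h19, h20, h21, h22,
    h23, h24⟩ := hadm
  by_contra! hd
  obtain ⟨rfl, rfl⟩ := hd
  have hc : c1C ≠ 0 ∨ c1D ≠ 0 := by
    by_contra! hc
    obtain ⟨rfl, rfl⟩ := hc
    simp at h19
  have hdef' := hdef.resolve_right (by simp)
  have hcwC : cwC = 0 := by
    rcases hc with h | h
    · exact (mul_eq_zero.1 h5).resolve_right h
    · exact (mul_eq_zero.1 h6).resolve_right h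
  have hdwC : dwC = 0 := by
    rcases hc with h | h <;> simp_all
  have hdwD : dwD = 2 * (dCz - dCw) := by
    by_cases h : c1D = 0
    · have hc' : c1C ≠ 0 := hc.resolve_right (not_not.2 h)
      subst h
      have : dwD = 0 := (mul_eq_zero.1 (by linear_combination h24)).resolve_right hc'
      have : dCz - dCw = 0 :=
        (mul_eq_zero.1 (by linear_combination h19 - h20)).resolve_right hc'
      simp_all
    · apply mul_right_cancel₀ h
      linear_combination -h23
  have hcwD : cwD = 2 * (cCz - cCw) := by
    by_cases h : c1D = 0
    · have hc' : c1C ≠ 0 := hc.resolve_right (not_not.2 h)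
      subst h
      simp_all
    · apply mul_right_cancel₀ h
      linear_combination -h7
  have h := mul_sub_mul_eq_zero_of_orthogonal (a := cCz - cCw) (b := cDz - cDw)
    (a' := dCz - dCw) (b' := dDz - dDw) (x := c1C) (y := c1D)
    (by linear_combination h2 - h4) (by linear_combination h19 - h20) hc
  apply hdef'
  rw [hcwC, hdwC, hdwD, hcwD]
  linear_combination h

/-- In a definite admissible tuple the vector `(c1C, c1D)` is nonzero. -/
lemma Admissible.c1_ne_zero {K : Type*} [RCLike K]
    {cCz cCw cDz cDw dCz dCw dDz dDw c1C c1D cwC cwD d1C d1D dwC dwD : K}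
    (hadm : Admissible cCz cCw cDz cDw dCz dCw dDz dDw c1C c1D cwC cwD d1C d1D dwC dwD)
    (hdef : Definite cCz cCw cDz cDw dCz dCw dDz dDw c1C c1D cwC cwD d1C d1D dwC dwD) :
    c1C ≠ 0 ∨ c1D ≠ 0 := by
  have hd := hadm.d1_ne_zero hdef
  obtain ⟨-, -, -, -, -, -, -, -, -, h10, -, h12, h13, h14, h15, h16, -, -, h19, h20, h21, h22,
    h23, h24⟩ := hadm
  by_contra! hc
  obtain ⟨rfl, rfl⟩ := hc
  have hdef' := hdef.resolve_right (by simp)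
  have hdwD : dwD = 0 := by
    rcases hd with h | h
    · exact (mul_eq_zero.1 h15).resolve_right h
    · exact (mul_eq_zero.1 h16).resolve_right h
  have hcwD : cwD = 0 := by
    rcases hd with h | h <;> simp_all
  have hdwC : dwC = 2 * (dDz - dDw) := by
    by_cases h : d1C = 0
    · have hd' : d1D ≠ 0 := hd.resolve_left (not_not.2 h)
      subst h
      simp_all
    · apply mul_right_cancel₀ h
      linear_combination h14
  have hcwC : cwC = 2 * (cDz - cDw) := by
    by_cases h : d1C = 0
    · have hd' : d1D ≠ 0 := hd.resolve_left (not_not.2 h)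
      subst h
      have : cwC = 0 := (mul_eq_zero.1 (by linear_combination -h21)).resolve_right hd'
      have : cDz - cDw = 0 :=
        (mul_eq_zero.1 (by linear_combination h19 - h20)).resolve_right hd'
      simp_all
    · apply mul_right_cancel₀ h
      linear_combination h22
  have h := mul_sub_mul_eq_zero_of_orthogonal (a := cCz - cCw) (b := cDz - cDw)
    (a' := dCz - dCw) (b' := dDz - dDw) (x := d1C) (y := d1D)
    (by linear_combination h19 - h20) (by linear_combination h10 - h12) hd
  apply hdef'
  rw [hcwC, hdwC, hdwD, hcwD]
  linear_combination h

/-- Existence direction of the parameterization (Theorem 2.5 of the paper):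
every admissible and definite structure tuple for `gl_K(1|1)` admits a
parameterization by scalars `muC, nuC, muD, nuD, cz, cw, dz, dw, c1, d1`. -/
theorem admissible_definite_exists_parameterization {K : Type*} [RCLike K]
    (cCz cCw cDz cDw dCz dCw dDz dDw c1C c1D cwC cwD d1C d1D dwC dwD : K)
    (hadm : Admissible cCz cCw cDz cDw dCz dCw dDz dDw c1C c1D cwC cwD d1C d1D dwC dwD)
    (hdef : Definite cCz cCw cDz cDw dCz dCw dDz dDw c1C c1D cwC cwD d1C d1D dwC dwD) :
    ∃ muC nuC muD nuD cz cw dz dw c1 d1 : K,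
      cCz = muC*cz ∧ cDz = nuC*cz ∧ cCw = muC*cw ∧ cDw = nuC*cw ∧
      dCz = muD*dz ∧ dDz = nuD*dz ∧ dCw = muD*dw ∧ dDw = nuD*dw ∧
      c1C = nuC*c1 ∧ c1D = -(muC*c1) ∧ d1C = nuD*d1 ∧ d1D = -(muD*d1) ∧
      (nuC*muD - muC*nuD) * (dz*c1 - cz*d1) = 1 ∧
      (nuC*muD - muC*nuD) * (dw*c1 - cw*d1) = 1 ∧
      (nuC*muD - muC*nuD) ≠ 0 ∧
      ((cz - cw)*(dz - dw) ≠ 0 ∨ c1*d1 ≠ 0) := by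
  have hc := hadm.c1_ne_zero hdef
  have hd := hadm.d1_ne_zero hdef
  obtain ⟨-, h2, -, h4, -, -, -, -, -, h10, -, h12, -, -, -, -, -, -, h19, h20, -⟩ := hadm
  obtain ⟨cz, rfl, rfl⟩ := exists_eq_mul_of_orthogonal h2 hc
  obtain ⟨cw, rfl, rfl⟩ := exists_eq_mul_of_orthogonal h4 hc
  obtain ⟨dz, rfl, rfl⟩ := exists_eq_mul_of_orthogonal h10 hd
  obtain ⟨dw, rfl, rfl⟩ := exists_eq_mul_of_orthogonal h12 hd
  have hz : (c1C * -d1D - -c1D * d1C) * (dz * 1 - cz * 1) = 1 := by linear_combination h19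
  have hw : (c1C * -d1D - -c1D * d1C) * (dw * 1 - cw * 1) = 1 := by linear_combination h20
  exact ⟨-c1D, c1C, -d1D, d1C, cz, cw, dz, dw, 1, 1, rfl, rfl, rfl, rfl, rfl, rfl, rfl, rfl,
    by simp, by simp, by simp, by simp, hz, hw, left_ne_zero_of_mul_eq_one hz, by simp⟩
end

section
/- Conversely, let muC, nuC, muD, nuD, cz, cw, dz, dw, c1, d1 be scalars in K and set Delta := nuC*muD - muC*nuD. Assume Delta*(dz*c1 - cz*d1) = 1, Delta*(dw*c1 - cw*d1) = 1, and ((cz - cw)*(dz - dw) ≠ 0 or c1*d1 ≠ 0). Then the structure tuple defined by cCz = muC*cz, cDz = nuC*cz, cCw = muC*cw, cDw = nuC*cw, dCz = muD*dz, dDz = nuD*dz, dCw = muD*dw, dDw = nuD*dw, c1C = nuC*c1, c1D = -muC*c1, d1C = nuD*d1, d1D = -muD*d1, cwC = 0, dwD = 0, cwD = 2*muC*(cz - cw), dwC = 2*nuD*(dz - dw) is admissible and definite (it satisfies equations (i)–(xxiv) and condition (xxv)). (This is the parameterization of planed LRT Lie supergroup structures for gl_K(1|1) in Theorem 2.5 of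 the paper, sufficiency direction.) -/
/-- Sufficiency direction of the parameterization (Theorem 2.5 of the paper):
scalars `muC, nuC, muD, nuD, cz, cw, dz, dw, c1, d1` satisfying the two
determinant equations and the genericity condition define an admissible and
definite structure tuple for `gl_K(1|1)`. -/
theorem parameterization_gives_admissible_definite {K : Type*} [RCLike K]
    (muC nuC muD nuD cz cw dz dw c1 d1 : K)
    (h1 : (nuC*muD - muC*nuD) * (dz*c1 - cz*d1) = 1)
    (h2 : (nuC*muD - muC*nuD) * (dw*c1 - cw*d1) = 1)
    (h3 : (cz - cw)*(dz - dw) ≠ 0 ∨ c1*d1 ≠ 0) :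
    Admissible (muC*cz) (muC*cw) (nuC*cz) (nuC*cw)
      (muD*dz) (muD*dw) (nuD*dz) (nuD*dw)
      (nuC*c1) (-(muC*c1)) 0 (2*muC*(cz - cw))
      (nuD*d1) (-(muD*d1)) (2*nuD*(dz - dw)) 0 ∧
    Definite (muC*cz) (muC*cw) (nuC*cz) (nuC*cw)
      (muD*dz) (muD*dw) (nuD*dz) (nuD*dw)
      (nuC*c1) (-(muC*c1)) 0 (2*muC*(cz - cw))
      (nuD*d1) (-(muD*d1)) (2*nuD*(dz - dw)) 0 := by
  have hΔ : nuC*muD - muC*nuD ≠ 0 := left_ne_zero_of_mul_eq_one h1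
  have hrel : c1*(dz - dw) - d1*(cz - cw) = 0 := by
    refine (mul_eq_zero.mp ?_).resolve_left hΔ
    linear_combination h1 - h2
  refine ⟨?_, ?_⟩
  · unfold Admissible
    refine ⟨by ring, by ring, by ring, by ring, by ring, by ring, by ring, by ring, by ring,
      by ring, by ring, by ring, by ring, by ring, by ring, by ring, by ring, by ring,
      by linear_combination h1, by linear_combination h2,
      by linear_combination 2*muC*nuD*hrel, by linear_combination 2*nuC*nuD*hrel,
      by linear_combination -2*muC*muD*hrel, by linear_combination -2*muC*nuD*hrel⟩
  · refine h3.imp (fun h hz => mul_ne_zero hΔ h ?_) (fun h hz => mul_ne_zero hΔ h ?_)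
    · linear_combination hz
    · linear_combination -hz
end

section
/- A structure tuple over K is admissible and definite (satisfies equations (i)–(xxiv) and condition (xxv)) if and only if the following reduced conditions hold: cwC = 0, dwD = 0, cwD = 2*(cCz - cCw), dwC = 2*(dDz - dDw), det M_C = 0, det M_D = 0, together with the equations cCz*c1C + cDz*c1D = 0, cCw*c1C + cDw*c1D = 0, dCz*d1C + dDz*d1D = 0, dCw*d1C + dDw*d1D = 0, c1C*dCz + c1D*dDz + cCz*d1C + cDz*d1D = 1, c1C*dCw + c1D*dDw + cCw*d1C + cDw*d1D = 1, (cCz - cCw)*d1C + (dDz - dDw)*c1D = 0, (cDz - cDw)*d1C - (dDz - dDw)*c1C = 0, (dCz - dCw)*c1D - (cCz - cCw)*d1D = 0, and the reduced inequality: (cDw - cDz)*(dCw - dCz) - (cCw - cCz)*(dDw - dDz) ≠ 0 or c1C*d1D - c1D*d1C ≠ 0. -/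
/-- A `2 × 2` matrix with a nonzero kernel vector has zero determinant. -/
theorem det_eq_zero_of_kernel {F : Type*} [Field F] {a b c d x y : F}
    (h : x ≠ 0 ∨ y ≠ 0) (h₁ : a * x + b * y = 0) (h₂ : c * x + d * y = 0) :
    a * d - b * c = 0 := by
  rcases h with h | h
  · exact (mul_eq_zero.mp (by linear_combination d * h₁ - b * h₂ :
      (a * d - b * c) * x = 0)).resolve_right h
  · exact (mul_eq_zero.mp (by linear_combination a * h₂ - c * h₁ :
      (a * d - b * c) * y = 0)).resolve_right h

theorem eq_zero_of_mul_eq_zero_of_ne {F : Type*} [Field F] {a x y : F}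
    (h : x ≠ 0 ∨ y ≠ 0) (hx : a * x = 0) (hy : a * y = 0) : a = 0 := by
  rcases h with h | h
  · exact (mul_eq_zero.mp hx).resolve_right h
  · exact (mul_eq_zero.mp hy).resolve_right h

/-- A structure tuple is admissible and definite if and only if it satisfies the
reduced system of conditions obtained after Lemmas 2.2–2.4 of the paper. -/
theorem admissible_definite_iff_reduced {K : Type*} [RCLike K]
    (cCz cCw cDz cDw dCz dCw dDz dDw c1C c1D cwC cwD d1C d1D dwC dwD : K) :
    (Admissible cCz cCw cDz cDw dCz dCw dDz dDw c1C c1D cwC cwD d1C d1D dwC dwD ∧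
     Definite cCz cCw cDz cDw dCz dCw dDz dDw c1C c1D cwC cwD d1C d1D dwC dwD) ↔
    (cwC = 0 ∧ dwD = 0 ∧ cwD = 2*(cCz - cCw) ∧ dwC = 2*(dDz - dDw) ∧
     cCz*cDw - cDz*cCw = 0 ∧ dCz*dDw - dDz*dCw = 0 ∧
     cCz*c1C + cDz*c1D = 0 ∧ cCw*c1C + cDw*c1D = 0 ∧
     dCz*d1C + dDz*d1D = 0 ∧ dCw*d1C + dDw*d1D = 0 ∧
     c1C*dCz + c1D*dDz + cCz*d1C + cDz*d1D = 1 ∧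
     c1C*dCw + c1D*dDw + cCw*d1C + cDw*d1D = 1 ∧
     (cCz - cCw)*d1C + (dDz - dDw)*c1D = 0 ∧
     (cDz - cDw)*d1C - (dDz - dDw)*c1C = 0 ∧
     (dCz - dCw)*c1D - (cCz - cCw)*d1D = 0 ∧
     ((cDw - cDz)*(dCw - dCz) - (cCw - cCz)*(dDw - dDz) ≠ 0 ∨
      c1C*d1D - c1D*d1C ≠ 0)) := by
  constructor
  · rintro ⟨⟨h1, h2, h3, h4, h5, h6, h7, h8, h9, h10, h11, h12, h13, h14, h15, h16,
      -, -, h19, h20, h21, h22, h23, h24⟩, hdef⟩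
    unfold Definite at hdef
    have cwD_eq (hc : c1C ≠ 0 ∨ c1D ≠ 0) : cwD = 2 * (cCz - cCw) :=
      sub_eq_zero.mp <| eq_zero_of_mul_eq_zero_of_ne hc
        (by linear_combination h8 - 2 * h2 + 2 * h4) (by linear_combination -h7)
    have dwC_eq (hd : d1C ≠ 0 ∨ d1D ≠ 0) : dwC = 2 * (dDz - dDw) :=
      sub_eq_zero.mp <| eq_zero_of_mul_eq_zero_of_ne hd
        (by linear_combination h14) (by linear_combination -h13 - 2 * h10 + 2 * h12)
    have hc : c1C ≠ 0 ∨ c1D ≠ 0 := by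
      by_contra! h
      obtain ⟨rfl, rfl⟩ := h
      have hd : d1C ≠ 0 ∨ d1D ≠ 0 := by
        by_contra! h
        obtain ⟨rfl, rfl⟩ := h
        simp at h19
      have e1 : dwD = 0 := eq_zero_of_mul_eq_zero_of_ne hd h15 h16
      have e2 := dwC_eq hd
      have e3 : cwD = 0 := eq_zero_of_mul_eq_zero_of_ne hd
        (by linear_combination h24) (by linear_combination -h23)
      subst e1 e2 e3
      have hk : (cCz - cCw) * (dDz - dDw) - (cDz - cDw) * (dCz - dCw) = 0 :=
        det_eq_zero_of_kernel hd (by linear_combination h19 - h20)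
          (by linear_combination h10 - h12)
      have e4 : cwC = 2 * (cDz - cDw) := by
        by_contra hne
        have hne' : cwC - 2 * (cDz - cDw) ≠ 0 := sub_ne_zero.mpr hne
        have k1 : d1C = 0 := (mul_eq_zero.mp (by linear_combination h22 :
          (cwC - 2 * (cDz - cDw)) * d1C = 0)).resolve_left hne'
        have k2 : cCz = 0 := (mul_eq_zero.mp (by linear_combination h1 :
          (cwC - 2 * (cDz - cDw)) * cCz = 0)).resolve_left hne'
        have k3 : cCw = 0 := (mul_eq_zero.mp (by linear_combination h3 :
          (cwC - 2 * (cDz - cDw)) * cCw = 0)).resolve_left hne'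
        subst k1 k2 k3
        have k4 : d1D ≠ 0 := by simpa using hd
        exact hne' ((mul_eq_zero.mp (by linear_combination -h21 - 2 * h19 + 2 * h20 :
          (cwC - 2 * (cDz - cDw)) * d1D = 0)).resolve_right k4)
      subst e4
      rcases hdef with h | h
      · exact h (by linear_combination hk)
      · exact h (by ring)
    have hd : d1C ≠ 0 ∨ d1D ≠ 0 := by
      by_contra! h
      obtain ⟨rfl, rfl⟩ := h
      have e1 : cwC = 0 := eq_zero_of_mul_eq_zero_of_ne hc h5 h6
      have e2 := cwD_eq hc
      have e3 : dwC = 0 := eq_zero_of_mul_eq_zero_of_ne hc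
        (by linear_combination h22) (by linear_combination -h21)
      subst e1 e2 e3
      have hk : (cCz - cCw) * (dDz - dDw) - (cDz - cDw) * (dCz - dCw) = 0 :=
        det_eq_zero_of_kernel hc (by linear_combination h2 - h4)
          (by linear_combination h19 - h20)
      have e4 : dwD = 2 * (dCz - dCw) := by
        by_contra hne
        have hne' : dwD - 2 * (dCz - dCw) ≠ 0 := sub_ne_zero.mpr hne
        have k1 : c1D = 0 := (mul_eq_zero.mp (by linear_combination -h23 :
          (dwD - 2 * (dCz - dCw)) * c1D = 0)).resolve_left hne'
        have k2 : dDz = 0 := (mul_eq_zero.mp (by linear_combination h9 :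
          (dwD - 2 * (dCz - dCw)) * dDz = 0)).resolve_left hne'
        have k3 : dDw = 0 := (mul_eq_zero.mp (by linear_combination h11 :
          (dwD - 2 * (dCz - dCw)) * dDw = 0)).resolve_left hne'
        subst k1 k2 k3
        have k4 : c1C ≠ 0 := by simpa using hc
        exact hne' ((mul_eq_zero.mp (by linear_combination h24 - 2 * h19 + 2 * h20 :
          (dwD - 2 * (dCz - dCw)) * c1C = 0)).resolve_right k4)
      subst e4
      rcases hdef with h | h
      · exact h (by linear_combination hk)
      · exact h (by ring)
    have e1 : cwC = 0 := eq_zero_of_mul_eq_zero_of_ne hc h5 h6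
    have e2 : dwD = 0 := eq_zero_of_mul_eq_zero_of_ne hd h15 h16
    have e3 := cwD_eq hc
    have e4 := dwC_eq hd
    subst e1 e2 e3 e4
    refine ⟨rfl, rfl, rfl, rfl, det_eq_zero_of_kernel hc h2 h4,
      det_eq_zero_of_kernel hd h10 h12, h2, h4, h10, h12, h19, h20,
      by linear_combination (-1 / 2) * h21, by linear_combination (-1 / 2) * h22,
      by linear_combination (1 / 2) * h23, hdef.imp_left fun h h' => h ?_⟩
    linear_combination h'
  · rintro ⟨rfl, rfl, rfl, rfl, hC, hD, h2, h4, h10, h12, h19, h20, h21, h22, h23, hdef⟩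
    refine ⟨⟨?_, h2, ?_, h4, ?_, ?_, ?_, ?_, ?_, h10, ?_, h12, ?_, ?_, ?_, ?_, ?_, ?_,
      h19, h20, ?_, ?_, ?_, ?_⟩, hdef.imp_left fun h h' => h ?_⟩
    · linear_combination 2 * hC
    · linear_combination 2 * hC
    · ring
    · ring
    · ring
    · linear_combination 2 * h2 - 2 * h4
    · linear_combination -2 * hD
    · linear_combination -2 * hD
    · linear_combination 2 * h12 - 2 * h10
    · ring
    · ring
    · ring
    · ring
    · ring
    · linear_combination -2 * h21
    · linear_combination -2 * h22
    · linear_combination 2 * h23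
    · linear_combination 2 * h21
    · linear_combination h'
end

section
/- If a structure tuple over K is admissible and definite (satisfies equations (i)–(xxiv) and condition (xxv)), then det M_C = 0 and det M_D = 0, i.e. cCz*cDw - cDz*cCw = 0 and dCz*dDw - dDz*dCw = 0. (Lemma 2.2 of the paper.) -/
/-- If a `2 × 2` matrix with nonzero determinant kills a vector, that vector is zero. -/
theorem eq_zero_and_eq_zero_of_det_ne_zero {K : Type*} [Field K] {p q r s x y : K}
    (hdet : p * s - q * r ≠ 0) (h₁ : p * x + q * y = 0) (h₂ : r * x + s * y = 0) :
    x = 0 ∧ y = 0 :=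
  ⟨(mul_eq_zero.mp (by linear_combination s * h₁ - q * h₂ :
      (p * s - q * r) * x = 0)).resolve_left hdet,
    (mul_eq_zero.mp (by linear_combination p * h₂ - r * h₁ :
      (p * s - q * r) * y = 0)).resolve_left hdet⟩

/-- The half of the structural equations needed for `det M_C = 0`; exchanging the roles of `C, c`
and `D, d` gives the half needed for `det M_D = 0`. -/
theorem det_eq_zero_of_half_admissible {K : Type*} [Field K]
    {cCz cCw cDz cDw dCz dCw dDz dDw c1C c1D cwC cwD d1C d1D dwC dwD : K}
    (hcz : 2 * cCz * cDw - 2 * cCz * cDz + cCz * cwC + cDz * cwD = 0)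
    (hcz₁ : cCz * c1C + cDz * c1D = 0)
    (hcw : 2 * cCw * cDw - 2 * cCw * cDz + cCw * cwC + cDw * cwD = 0)
    (hcw₁ : cCw * c1C + cDw * c1D = 0)
    (hdz₁ : dCz * d1C + dDz * d1D = 0)
    (hdw₁ : dCw * d1C + dDw * d1D = 0)
    (hdC : 2 * dCw * d1C - 2 * dCz * d1C - dwC * d1D = 0)
    (hdD : 2 * dDw * d1C - 2 * dDz * d1C + dwC * d1C = 0)
    (hwC : dwD * d1C = 0)
    (hwD : dwD * d1D = 0)
    (hz : c1C * dCz + c1D * dDz + cCz * d1C + cDz * d1D = 1)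
    (hw : c1C * dCw + c1D * dDw + cCw * d1C + cDw * d1D = 1)
    (hdef : (cDw - cDz + cwC) * (dCw - dCz + dwD) - (cCw - cCz + cwD) * (dDw - dDz + dwC) ≠ 0 ∨
      c1C * d1D - c1D * d1C ≠ 0) :
    cCz * cDw - cDz * cCw = 0 := by
  by_contra hdet
  obtain ⟨rfl, rfl⟩ := eq_zero_and_eq_zero_of_det_ne_zero hdet hcz₁ hcw₁
  obtain ⟨hcwC, rfl⟩ := eq_zero_and_eq_zero_of_det_ne_zero (x := 2 * cDw - 2 * cDz + cwC)
    (y := cwD) hdet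
    (by linear_combination hcz) (by linear_combination hcw)
  obtain rfl : cwC = -2 * (cDw - cDz) := by linear_combination hcwC
  have hc : (cCw - cCz) * d1C + (cDw - cDz) * d1D = 0 := by linear_combination hw - hz
  have hd : (dCw - dCz) * d1C + (dDw - dDz) * d1D = 0 := by linear_combination hdw₁ - hdz₁
  refine hdef.elim (fun h ↦ h ?_) (fun h ↦ h (by ring))
  by_cases hC : d1C = 0
  · subst hC
    have hD : d1D ≠ 0 := by
      rintro rfl
      simp at hz
    have hdwD : dwD = 0 := (mul_eq_zero.mp hwD).resolve_right hD
    have hdwC : dwC = 0 :=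
      (mul_eq_zero.mp (by linear_combination -hdC : dwC * d1D = 0)).resolve_right hD
    have hb : cDw - cDz = 0 :=
      (mul_eq_zero.mp (by linear_combination hc : (cDw - cDz) * d1D = 0)).resolve_right hD
    have hb' : dDw - dDz = 0 :=
      (mul_eq_zero.mp (by linear_combination hd : (dDw - dDz) * d1D = 0)).resolve_right hD
    linear_combination -(dCw - dCz + dwD) * hb - (cCw - cCz) * hb' - (cCw - cCz) * hdwC
  · have hdwD : dwD = 0 := (mul_eq_zero.mp hwC).resolve_right hC
    have hdwC : 2 * (dDw - dDz) + dwC = 0 := (mul_eq_zero.mp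
      (by linear_combination hdD : (2 * (dDw - dDz) + dwC) * d1C = 0)).resolve_right hC
    refine (mul_eq_zero.mp (?_ : _ * d1C = 0)).resolve_right hC
    linear_combination (dDw - dDz) * hc - (cDw - cDz) * hd
      - (cCw - cCz) * d1C * hdwC - (cDw - cDz) * d1C * hdwD

/-- Lemma 2.2 of the paper: an admissible and definite structure tuple satisfies
`det M_C = 0` and `det M_D = 0`. -/
theorem det_MC_eq_zero_and_det_MD_eq_zero {K : Type*} [RCLike K]
    (cCz cCw cDz cDw dCz dCw dDz dDw c1C c1D cwC cwD d1C d1D dwC dwD : K)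
    (hadm : Admissible cCz cCw cDz cDw dCz dCw dDz dDw c1C c1D cwC cwD d1C d1D dwC dwD)
    (hdef : Definite cCz cCw cDz cDw dCz dCw dDz dDw c1C c1D cwC cwD d1C d1D dwC dwD) :
    cCz*cDw - cDz*cCw = 0 ∧ dCz*dDw - dDz*dCw = 0 := by
  obtain ⟨h₁, h₂, h₃, h₄, h₅, h₆, h₇, h₈, h₉, h₁₀, h₁₁, h₁₂, h₁₃, h₁₄, h₁₅, h₁₆, -, -, h₁₉, h₂₀, -⟩ :=
    hadm
  refine ⟨det_eq_zero_of_half_admissible h₁ h₂ h₃ h₄ h₁₀ h₁₂ h₁₃ h₁₄ h₁₅ h₁₆ h₁₉ h₂₀ hdef, ?_⟩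
  have hD : dDz * dCw - dCz * dDw = 0 :=
    det_eq_zero_of_half_admissible (cCz := dDz) (cCw := dDw) (cDz := dCz) (cDw := dCw)
      (dCz := cDz) (dCw := cDw) (dDz := cCz) (dDw := cCw) (c1C := d1D) (c1D := d1C)
      (cwC := dwD) (cwD := dwC) (d1C := c1D) (d1D := c1C) (dwC := cwD) (dwD := cwC)
      (by linear_combination h₉) (by linear_combination h₁₀) (by linear_combination h₁₁)
      (by linear_combination h₁₂) (by linear_combination h₂) (by linear_combination h₄)
      (by linear_combination -h₈) (by linear_combination -h₇) h₆ h₅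
      (by linear_combination h₁₉) (by linear_combination h₂₀)
      (hdef.imp (fun h ↦ by convert h using 1; ring) (fun h ↦ by convert h using 1; ring))
  linear_combination -hD
end

section
/- If a structure tuple over K is admissible and definite (satisfies equations (i)–(xxiv) and condition (xxv)), then cwC = 0 and dwD = 0. (Lemma 2.3 of the paper.) -/
/-- Admissibility is invariant under exchanging the roles of `C` and `D`. -/
theorem Admissible.swap {K : Type*} [RCLike K]
    {cCz cCw cDz cDw dCz dCw dDz dDw c1C c1D cwC cwD d1C d1D dwC dwD : K}
    (h : Admissible cCz cCw cDz cDw dCz dCw dDz dDw c1C c1D cwC cwD d1C d1D dwC dwD) :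
    Admissible dDz dDw dCz dCw cDz cDw cCz cCw d1D d1C dwD dwC c1D c1C cwD cwC := by
  obtain ⟨h1, h2, h3, h4, h5, h6, h7, h8, h9, h10, h11, h12, h13, h14, h15, h16, h17, h18,
    h19, h20, h21, h22, h23, h24⟩ := h
  refine ⟨?_, ?_, ?_, ?_, ?_, ?_, ?_, ?_, ?_, ?_, ?_, ?_, ?_, ?_, ?_, ?_, ?_, ?_, ?_, ?_, ?_, ?_,
    ?_, ?_⟩
  · linear_combination h9
  · linear_combination h10
  · linear_combination h11
  · linear_combination h12
  · exact h16
  · exact h15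
  · linear_combination -h14
  · linear_combination -h13
  · linear_combination h1
  · linear_combination h2
  · linear_combination h3
  · linear_combination h4
  · linear_combination -h8
  · linear_combination -h7
  · exact h6
  · exact h5
  · linear_combination h17
  · linear_combination h18
  · linear_combination h19
  · linear_combination h20
  · linear_combination -h24
  · linear_combination -h23
  · linear_combination -h22
  · linear_combination -h21

/-- Definiteness is invariant under exchanging the roles of `C` and `D`. -/
theorem Definite.swap {K : Type*} [RCLike K]
    {cCz cCw cDz cDw dCz dCw dDz dDw c1C c1D cwC cwD d1C d1D dwC dwD : K}
    (h : Definite cCz cCw cDz cDw dCz dCw dDz dDw c1C c1D cwC cwD d1C d1D dwC dwD) :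
    Definite dDz dDw dCz dCw cDz cDw cCz cCw d1D d1C dwD dwC c1D c1C cwD cwC :=
  h.imp (fun h e => h (by linear_combination e)) (fun h e => h (by linear_combination e))

theorem Admissible.cwC_eq_zero {K : Type*} [RCLike K]
    {cCz cCw cDz cDw dCz dCw dDz dDw c1C c1D cwC cwD d1C d1D dwC dwD : K}
    (hadm : Admissible cCz cCw cDz cDw dCz dCw dDz dDw c1C c1D cwC cwD d1C d1D dwC dwD)
    (hdef : Definite cCz cCw cDz cDw dCz dCw dDz dDw c1C c1D cwC cwD d1C d1D dwC dwD) :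
    cwC = 0 := by
  obtain ⟨-, -, -, -, h5, h6, -, -, -, -, -, -, h13, h14, h15, -, -, -,
    h19, -, h21, h22, -, h24⟩ := hadm
  by_contra hc
  obtain rfl : c1C = 0 := (mul_eq_zero.mp h5).resolve_left hc
  obtain rfl : c1D = 0 := (mul_eq_zero.mp h6).resolve_left hc
  have hC : d1C ≠ 0 := by
    rintro rfl
    have hD : d1D = 0 :=
      (mul_eq_zero.mp (show cwC * d1D = 0 by linear_combination -h21)).resolve_left hc
    simp [hD] at h19
  obtain rfl : dwD = 0 := (mul_eq_zero.mp h15).resolve_right hC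
  obtain rfl : cwD = 0 :=
    (mul_eq_zero.mp (show cwD * d1C = 0 by linear_combination h24)).resolve_right hC
  have eC : 2 * (cDw - cDz) + cwC = 0 :=
    (mul_eq_zero.mp (show _ * d1C = 0 by linear_combination h22)).resolve_right hC
  have eD : 2 * (dDw - dDz) + dwC = 0 :=
    (mul_eq_zero.mp (show _ * d1C = 0 by linear_combination h14)).resolve_right hC
  rcases hdef with h | h
  · refine h ((mul_eq_zero.mp (show _ * d1C = 0 from ?_)).resolve_right hC)
    linear_combination (dCw - dCz) * d1C / 2 * eC - (cCw - cCz) * d1C / 2 * eD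
      + cwC / 4 * h13 - dwC / 4 * h21
  · exact h (by ring)

/-- Lemma 2.3 of the paper: an admissible and definite structure tuple satisfies
`c_∧^{C*} = 0` and `d_∧^{D*} = 0`. -/
theorem cwC_eq_zero_and_dwD_eq_zero {K : Type*} [RCLike K]
    (cCz cCw cDz cDw dCz dCw dDz dDw c1C c1D cwC cwD d1C d1D dwC dwD : K)
    (hadm : Admissible cCz cCw cDz cDw dCz dCw dDz dDw c1C c1D cwC cwD d1C d1D dwC dwD)
    (hdef : Definite cCz cCw cDz cDw dCz dCw dDz dDw c1C c1D cwC cwD d1C d1D dwC dwD) :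
    cwC = 0 ∧ dwD = 0 :=
  ⟨hadm.cwC_eq_zero hdef, hadm.swap.cwC_eq_zero hdef.swap⟩
end

section
/- If a structure tuple over K is admissible and definite (satisfies equations (i)–(xxiv) and condition (xxv)), then cwD = 2*(cCz - cCw) and dwC = 2*(dDz - dDw). (Lemma 2.4 of the paper.) -/
/-- If `x` annihilates two plane vectors and is nonzero, these vectors are dependent. -/
theorem mul_sub_mul_eq_zero_of_annihilated {K : Type*} [Field K] {a b p q x y : K}
    (hab : a * x + b * y = 0) (hpq : p * x + q * y = 0) (hxy : x ≠ 0 ∨ y ≠ 0) :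
    a * q - b * p = 0 := by
  rcases hxy with h | h
  · exact (mul_eq_zero.mp (by linear_combination q * hab - b * hpq :
      x * (a * q - b * p) = 0)).resolve_left h
  · exact (mul_eq_zero.mp (by linear_combination a * hpq - p * hab :
      y * (a * q - b * p) = 0)).resolve_left h

/-- Lemma 2.4 of the paper: an admissible and definite structure tuple satisfies
`c_∧^{D*} = 2(c_{C*}^z - c_{C*}^w)` and `d_∧^{C*} = 2(d_{D*}^z - d_{D*}^w)`. -/
theorem cwD_and_dwC_formulas {K : Type*} [RCLike K]
    (cCz cCw cDz cDw dCz dCw dDz dDw c1C c1D cwC cwD d1C d1D dwC dwD : K)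
    (hadm : Admissible cCz cCw cDz cDw dCz dCw dDz dDw c1C c1D cwC cwD d1C d1D dwC dwD)
    (hdef : Definite cCz cCw cDz cDw dCz dCw dDz dDw c1C c1D cwC cwD d1C d1D dwC dwD) :
    cwD = 2*(cCz - cCw) ∧ dwC = 2*(dDz - dDw) := by
  obtain ⟨-, e2, -, e4, e5, e6, e7, e8, -, e10, -, e12, e13, e14, e15, e16, -, -, e19, e20,
    e21, e22, e23, e24⟩ := hadm
  unfold Definite at hdef
  have hdc : (cCw - cCz) * c1C + (cDw - cDz) * c1D = 0 := by linear_combination e4 - e2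
  have hdd : (dCw - dCz) * d1C + (dDw - dDz) * d1D = 0 := by linear_combination e12 - e10
  have hmix : (dCw - dCz) * c1C + (dDw - dDz) * c1D
      + ((cCw - cCz) * d1C + (cDw - cDz) * d1D) = 0 := by linear_combination e20 - e19
  have hT : c1D ≠ 0 → cwD = 2 * (cCz - cCw) := fun h =>
    mul_right_cancel₀ h (by linear_combination -e7)
  have hU : d1C ≠ 0 → dwC = 2 * (dDz - dDw) := fun h =>
    mul_right_cancel₀ h (by linear_combination e14)
  by_cases hc : c1C = 0 ∧ c1D = 0
  · obtain ⟨rfl, rfl⟩ := hc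
    have hne : d1C ≠ 0 ∨ d1D ≠ 0 := by
      by_contra! h
      simp [h.1, h.2] at e19
    have hdep := mul_sub_mul_eq_zero_of_annihilated
      (a := cCw - cCz) (b := cDw - cDz) (by linear_combination hmix) hdd hne
    by_cases h : d1C = 0
    · grind
    · grind
  by_cases hd : d1C = 0 ∧ d1D = 0
  · obtain ⟨rfl, rfl⟩ := hd
    have hdep := mul_sub_mul_eq_zero_of_annihilated
      (p := dCw - dCz) (q := dDw - dDz) hdc (by linear_combination hmix) (by tauto)
    by_cases h : c1D = 0
    · grind
    · grind
  constructor
  · by_cases h : c1D = 0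
    · grind
    · exact hT h
  · by_cases h : d1C = 0
    · grind
    · exact hU h
end

section
/- If a structure tuple over K satisfies equations (ii), (iv), (x), (xii) and (xix), then it is not the case that both det M_C ≠ 0 and det M_D ≠ 0; i.e. cCz*cDw - cDz*cCw = 0 or dCz*dDw - dDz*dCw = 0. (This is the observation preceding Lemma 2.2: if both determinants were nonzero, then M_1 = 0, contradicting equation (xix).) -/
/-- The observation preceding Lemma 2.2 of the paper: if a structure tuple satisfies
equations (ii), (iv), (x), (xii) and (xix), then `det M_C` and `det M_D` cannot both
be nonzero. -/
theorem not_both_det_nonzero {K : Type*} [RCLike K]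
    (cCz cCw cDz cDw dCz dCw dDz dDw c1C c1D d1C d1D : K)
    (hii : cCz*c1C + cDz*c1D = 0)
    (hiv : cCw*c1C + cDw*c1D = 0)
    (hx : dCz*d1C + dDz*d1D = 0)
    (hxii : dCw*d1C + dDw*d1D = 0)
    (hxix : c1C*dCz + c1D*dDz + cCz*d1C + cDz*d1D = 1) :
    cCz*cDw - cDz*cCw = 0 ∨ dCz*dDw - dDz*dCw = 0 := by
  rw [← mul_eq_zero]
  linear_combination
    -((cCz*cDw - cDz*cCw) * (dCz*dDw - dDz*dCw)) * hxix
      + (dCz*dDw - dDz*dCw) * (dCz * (cDw*hii - cDz*hiv) + dDz * (cCz*hiv - cCw*hii))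
      + (cCz*cDw - cDz*cCw) * (cCz * (dDw*hx - dDz*hxii) + cDz * (dCz*hxii - dCw*hx))
end

section
/- If a structure tuple over K is admissible (satisfies equations (i)–(xxiv)) and cwC ≠ 0, then c1C = 0, c1D = 0, (d1C, d1D) ≠ (0, 0), cwD = 0, and dwD = 0. (This is the first step in the proof of Lemma 2.3 of the paper.) -/
/-- First step in the proof of Lemma 2.3 of the paper: if a structure tuple is
admissible and `c_∧^{C*} ≠ 0`, then `c_1^{C*} = c_1^{D*} = 0`,
`(d_1^{C*}, d_1^{D*}) ≠ (0,0)`, `c_∧^{D*} = 0` and `d_∧^{D*} = 0`. -/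
theorem admissible_cwC_ne_zero_consequences {K : Type*} [RCLike K]
    (cCz cCw cDz cDw dCz dCw dDz dDw c1C c1D cwC cwD d1C d1D dwC dwD : K)
    (hadm : Admissible cCz cCw cDz cDw dCz dCw dDz dDw c1C c1D cwC cwD d1C d1D dwC dwD)
    (hcwC : cwC ≠ 0) :
    c1C = 0 ∧ c1D = 0 ∧ ¬(d1C = 0 ∧ d1D = 0) ∧ cwD = 0 ∧ dwD = 0 := by
  obtain ⟨-, -, -, -, hC, hD, -, -, -, -, -, -, -, -, hwDC, hwDD, -, -, hz, -, -, -, hcD, hcC⟩ :=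
    hadm
  obtain rfl : c1C = 0 := (mul_eq_zero.mp hC).resolve_left hcwC
  obtain rfl : c1D = 0 := (mul_eq_zero.mp hD).resolve_left hcwC
  have hd : ¬(d1C = 0 ∧ d1D = 0) := by
    rintro ⟨rfl, rfl⟩
    simp at hz
  refine ⟨rfl, rfl, hd, ?_, ?_⟩
  · by_contra h
    exact hd ⟨by simpa [h] using hcC, by simpa [h] using hcD⟩
  · by_contra h
    exact hd ⟨(mul_eq_zero.mp hwDC).resolve_left h, (mul_eq_zero.mp hwDD).resolve_left h⟩
end

section
/- For all x, y in K with x ≠ 0 and y ≠ 0 and all u, v in K with x*y = u + v, the linear map T⁺ : K⁴ → K⁴ determined by T⁺(eA) = u·eA + (u-1)·eB, T⁺(eB) = v·eA + (v+1)·eB, T⁺(eC) = x·eC, T⁺(eD) = y·eD is bijective, maps span{eA,eB} to span{eA,eB} and span{eC,eD} to span{eC,eD}, and satisfies T⁺(β(X,Y)) = β(T⁺(X), T⁺(Y)) for all X, Y in K⁴; likewise the linear map T⁻ determined by T⁻(eA) = u·eA + (u+1)·eB, T⁻(eB) = v·eA + (v-1)·eB, T⁻(eC) = x·eD, T⁻(eD)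 = y·eC has the same properties. (These are the even automorphisms ψ⁺_{x,y,u,v} and ψ⁻_{x,y,u,v} of the Lie superalgebra gl_K(1|1).) -/
/-- The basis vector `A` of `gl_K(1|1)`. -/
def eA (K : Type*) [RCLike K] : Fin 4 → K := ![1, 0, 0, 0]
/-- The basis vector `B` of `gl_K(1|1)`. -/
def eB (K : Type*) [RCLike K] : Fin 4 → K := ![0, 1, 0, 0]
/-- The basis vector `C` of `gl_K(1|1)`. -/
def eC (K : Type*) [RCLike K] : Fin 4 → K := ![0, 0, 1, 0]
/-- The basis vector `D` of `gl_K(1|1)`. -/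
def eD (K : Type*) [RCLike K] : Fin 4 → K := ![0, 0, 0, 1]

/-- `β` is the superbracket of `gl_K(1|1)`: the (unique) bilinear map with the
prescribed values on the basis `eA, eB, eC, eD`. -/
def IsSuperBracket (K : Type*) [RCLike K]
    (β : (Fin 4 → K) →ₗ[K] (Fin 4 → K) →ₗ[K] (Fin 4 → K)) : Prop :=
  β (eA K) (eA K) = 0 ∧ β (eA K) (eB K) = 0 ∧ β (eB K) (eA K) = 0 ∧ β (eB K) (eB K) = 0 ∧
  β (eA K) (eC K) = eC K ∧ β (eC K) (eA K) = -(eC K) ∧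
  β (eB K) (eC K) = -(eC K) ∧ β (eC K) (eB K) = eC K ∧
  β (eA K) (eD K) = -(eD K) ∧ β (eD K) (eA K) = eD K ∧
  β (eB K) (eD K) = eD K ∧ β (eD K) (eB K) = -(eD K) ∧
  β (eC K) (eD K) = eA K + eB K ∧ β (eD K) (eC K) = eA K + eB K ∧
  β (eC K) (eC K) = 0 ∧ β (eD K) (eD K) = 0

/-- Linear maps on `K⁴` agreeing on `eA, eB, eC, eD` are equal. -/
theorem linearMap_ext_eABCD {K M : Type*} [RCLike K] [AddCommMonoid M] [Module K M]
    {f g : (Fin 4 → K) →ₗ[K] M} (hA : f (eA K) = g (eA K)) (hB : f (eB K) = g (eB K))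
    (hC : f (eC K) = g (eC K)) (hD : f (eD K) = g (eD K)) : f = g := by
  ext1 i
  ext
  have h0 : (Pi.single 0 1 : Fin 4 → K) = eA K := by
    ext i; fin_cases i <;> simp [eA]
  have h1 : (Pi.single 1 1 : Fin 4 → K) = eB K := by
    ext i; fin_cases i <;> simp [eB]
  have h2 : (Pi.single 2 1 : Fin 4 → K) = eC K := by
    ext i; fin_cases i <;> simp [eC]
  have h3 : (Pi.single 3 1 : Fin 4 → K) = eD K := by
    ext i; fin_cases i <;> simp [eD]
  fin_cases i <;> simp [h0, h1, h2, h3, hA, hB, hC, hD]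

theorem span_even_sup_span_odd (K : Type*) [RCLike K] :
    Submodule.span K {eA K, eB K} ⊔ Submodule.span K {eC K, eD K} = ⊤ := by
  rw [eq_top_iff]
  intro X _
  refine Submodule.mem_sup.2 ⟨X 0 • eA K + X 1 • eB K, ?_, X 2 • eC K + X 3 • eD K, ?_, ?_⟩
  · exact Submodule.mem_span_pair.2 ⟨_, _, rfl⟩
  · exact Submodule.mem_span_pair.2 ⟨_, _, rfl⟩
  · ext i
    fin_cases i <;> simp [eA, eB, eC, eD]

/-- An invertible linear substitution does not change the span of a pair of vectors. -/
theorem span_pair_eq_of_det_ne_zero {K M : Type*} [Field K] [AddCommGroup M] [Module K M]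
    (a b : M) {p q r s : K} (h : p * s - q * r ≠ 0) :
    Submodule.span K {p • a + q • b, r • a + s • b} = Submodule.span K {a, b} := by
  apply le_antisymm <;> rw [Submodule.span_le, Set.pair_subset_iff]
  · exact ⟨Submodule.mem_span_pair.2 ⟨p, q, rfl⟩, Submodule.mem_span_pair.2 ⟨r, s, rfl⟩⟩
  · constructor <;> refine (Submodule.smul_mem_iff _ h).1 (Submodule.mem_span_pair.2 ?_)
    · exact ⟨s, -q, by module⟩
    · exact ⟨-r, p, by module⟩

theorem span_smul_pair {K M : Type*} [Field K] [AddCommGroup M] [Module K M]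
    (a b : M) {x y : K} (hx : x ≠ 0) (hy : y ≠ 0) :
    Submodule.span K {x • a, y • b} = Submodule.span K {a, b} := by
  simpa using span_pair_eq_of_det_ne_zero a b (p := x) (q := 0) (r := 0) (s := y) (by simp [hx, hy])

theorem bijective_of_map_span_even_odd {K : Type*} [RCLike K]
    {T : (Fin 4 → K) →ₗ[K] (Fin 4 → K)}
    (h₀ : Submodule.map T (Submodule.span K {eA K, eB K}) = Submodule.span K {eA K, eB K})
    (h₁ : Submodule.map T (Submodule.span K {eC K, eD K}) = Submodule.span K {eC K, eD K}) :
    Function.Bijective T := by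
  have hs : Function.Surjective T := by
    rw [← LinearMap.range_eq_top, LinearMap.range_eq_map, ← span_even_sup_span_odd K,
      Submodule.map_sup, h₀, h₁]
  exact ⟨LinearMap.injective_iff_surjective.2 hs, hs⟩

/-- The maps `ψ⁺_{x,y,u,v}` and `ψ⁻_{x,y,u,v}` (for `x, y ≠ 0`, `x*y = u + v`) are
even automorphisms of the Lie superalgebra `gl_K(1|1)`: they are bijective,
preserve the even part `span{eA, eB}` and the odd part `span{eC, eD}`, and
commute with the superbracket `β`. -/
theorem psiPlus_psiMinus_are_even_automorphisms {K : Type*} [RCLike K]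
    (x y u v : K) (hx : x ≠ 0) (hy : y ≠ 0) (hxy : x*y = u + v)
    (β : (Fin 4 → K) →ₗ[K] (Fin 4 → K) →ₗ[K] (Fin 4 → K))
    (hβ : IsSuperBracket K β)
    (Tp Tm : (Fin 4 → K) →ₗ[K] (Fin 4 → K))
    (hTpA : Tp (eA K) = u • eA K + (u - 1) • eB K)
    (hTpB : Tp (eB K) = v • eA K + (v + 1) • eB K)
    (hTpC : Tp (eC K) = x • eC K)
    (hTpD : Tp (eD K) = y • eD K)
    (hTmA : Tm (eA K) = u • eA K + (u + 1) • eB K)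
    (hTmB : Tm (eB K) = v • eA K + (v - 1) • eB K)
    (hTmC : Tm (eC K) = x • eD K)
    (hTmD : Tm (eD K) = y • eC K) :
    (Function.Bijective Tp ∧
      Submodule.map Tp (Submodule.span K {eA K, eB K}) = Submodule.span K {eA K, eB K} ∧
      Submodule.map Tp (Submodule.span K {eC K, eD K}) = Submodule.span K {eC K, eD K} ∧
      ∀ X Y : Fin 4 → K, Tp (β X Y) = β (Tp X) (Tp Y)) ∧
    (Function.Bijective Tm ∧
      Submodule.map Tm (Submodule.span K {eA K, eB K}) = Submodule.span K {eA K, eB K} ∧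
      Submodule.map Tm (Submodule.span K {eC K, eD K}) = Submodule.span K {eC K, eD K} ∧
      ∀ X Y : Fin 4 → K, Tm (β X Y) = β (Tm X) (Tm Y)) := by
  obtain ⟨hAA, hAB, hBA, hBB, hAC, hCA, hBC, hCB, hAD, hDA, hBD, hDB, hCD, hDC, hCC, hDD⟩ := hβ
  have hdet : u + v ≠ 0 := hxy ▸ mul_ne_zero hx hy
  have hv : v = x * y - u := by rw [hxy]; ring
  have hp₀ : Submodule.map Tp (Submodule.span K {eA K, eB K}) = Submodule.span K {eA K, eB K} := by
    rw [Submodule.map_span, Set.image_pair, hTpA, hTpB]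
    exact span_pair_eq_of_det_ne_zero _ _ (by convert hdet using 1; ring)
  have hp₁ : Submodule.map Tp (Submodule.span K {eC K, eD K}) = Submodule.span K {eC K, eD K} := by
    rw [Submodule.map_span, Set.image_pair, hTpC, hTpD, span_smul_pair _ _ hx hy]
  have hm₀ : Submodule.map Tm (Submodule.span K {eA K, eB K}) = Submodule.span K {eA K, eB K} := by
    rw [Submodule.map_span, Set.image_pair, hTmA, hTmB]
    exact span_pair_eq_of_det_ne_zero _ _ (by convert neg_ne_zero.2 hdet using 1; ring)
  have hm₁ : Submodule.map Tm (Submodule.span K {eC K, eD K}) = Submodule.span K {eC K, eD K} := by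
    rw [Submodule.map_span, Set.image_pair, hTmC, hTmD, span_smul_pair _ _ hx hy, Set.pair_comm]
  have hp : β.compr₂ Tp = β.compl₁₂ Tp Tp := by
    apply linearMap_ext_eABCD <;> apply linearMap_ext_eABCD <;>
    simp only [LinearMap.compr₂_apply, LinearMap.compl₁₂_apply, hTpA, hTpB, hTpC, hTpD, map_add,
      map_smul, map_neg, map_zero, LinearMap.add_apply, LinearMap.smul_apply, hAA, hAB, hBA, hBB,
      hAC, hCA, hBC, hCB, hAD, hDA, hBD, hDB, hCD, hDC, hCC, hDD, hv] <;>
    module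
  have hm : β.compr₂ Tm = β.compl₁₂ Tm Tm := by
    apply linearMap_ext_eABCD <;> apply linearMap_ext_eABCD <;>
    simp only [LinearMap.compr₂_apply, LinearMap.compl₁₂_apply, hTmA, hTmB, hTmC, hTmD, map_add,
      map_smul, map_neg, map_zero, LinearMap.add_apply, LinearMap.smul_apply, hAA, hAB, hBA, hBB,
      hAC, hCA, hBC, hCB, hAD, hDA, hBD, hDB, hCD, hDC, hCC, hDD, hv] <;>
    module
  exact ⟨⟨bijective_of_map_span_even_odd hp₀ hp₁, hp₀, hp₁,
      fun X Y => LinearMap.congr_fun₂ hp X Y⟩,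
    ⟨bijective_of_map_span_even_odd hm₀ hm₁, hm₀, hm₁,
      fun X Y => LinearMap.congr_fun₂ hm X Y⟩⟩
end

section
/- Every even automorphism T of gl_K(1|1) (i.e. every bijective K-linear map T : K⁴ → K⁴ with T(span{eA,eB}) = span{eA,eB}, T(span{eC,eD}) = span{eC,eD}, and T(β(X,Y)) = β(T(X),T(Y)) for all X, Y in K⁴) is of one of the following two forms: either there exist x, y in K with x ≠ 0, y ≠ 0 and u, v in K with x*y = u + v such that T(eA) = u·eA + (u-1)·eB, T(eB) = v·eA + (v+1)·eB, T(eC) = x·eC, T(eD) = y·eD; or there exist such x, y, u, v with x*y = u + v such that T(eA) = u·eA + (u+1)·eB, T(eB) = v·eA + (v-1)·eB, T(eC) = x·eD, T(eD) = y·eC. (This is the classification of the even Lie superalgebra automorphisms ψ±_{x,y,u,v} of gl_K(1|1) used in Section 2.2.2.) -/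
theorem IsSuperBracket.even_odd {K : Type*} [RCLike K]
    {β : (Fin 4 → K) →ₗ[K] (Fin 4 → K) →ₗ[K] (Fin 4 → K)} (hβ : IsSuperBracket K β)
    (a b p q : K) :
    β (a • eA K + b • eB K) (p • eC K + q • eD K) =
      ((a - b) * p) • eC K + (-((a - b) * q)) • eD K := by
  obtain ⟨-, -, -, -, hAC, -, hBC, -, hAD, -, hBD, -, -, -, -, -⟩ := hβ
  simp only [map_add, map_smul, LinearMap.add_apply, LinearMap.smul_apply, hAC, hBC, hAD, hBD]
  module

theorem IsSuperBracket.odd_odd {K : Type*} [RCLike K]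
    {β : (Fin 4 → K) →ₗ[K] (Fin 4 → K) →ₗ[K] (Fin 4 → K)} (hβ : IsSuperBracket K β)
    (p q r s : K) :
    β (p • eC K + q • eD K) (r • eC K + s • eD K) =
      (p * s + q * r) • eA K + (p * s + q * r) • eB K := by
  obtain ⟨-, -, -, -, -, -, -, -, -, -, -, -, hCD, hDC, hCC, hDD⟩ := hβ
  simp only [map_add, map_smul, LinearMap.add_apply, LinearMap.smul_apply, hCD, hDC, hCC, hDD]
  module

theorem smul_eA_add_smul_eB_inj {K : Type*} [RCLike K] {a b c d : K}
    (h : a • eA K + b • eB K = c • eA K + d • eB K) : a = c ∧ b = d :=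
  ⟨by simpa [eA, eB] using congrFun h 0, by simpa [eA, eB] using congrFun h 1⟩

theorem smul_eC_add_smul_eD_inj {K : Type*} [RCLike K] {a b c d : K}
    (h : a • eC K + b • eD K = c • eC K + d • eD K) : a = c ∧ b = d :=
  ⟨by simpa [eC, eD] using congrFun h 2, by simpa [eC, eD] using congrFun h 3⟩

theorem exists_smul_add_smul_of_map_span_pair {K V : Type*} [Field K] [AddCommGroup V] [Module K V]
    {T : V →ₗ[K] V} {x y z : V}
    (h : Submodule.map T (Submodule.span K {x, y}) = Submodule.span K {x, y})
    (hz : z ∈ ({x, y} : Set V)) : ∃ a b : K, T z = a • x + b • y := by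
  have hT : T z ∈ Submodule.span K {x, y} :=
    h ▸ Submodule.mem_map_of_mem (Submodule.subset_span hz)
  obtain ⟨a, b, hab⟩ := Submodule.mem_span_pair.1 hT
  exact ⟨a, b, hab.symm⟩

/-- Classification of the even automorphisms of `gl_K(1|1)` (Section 2.2.2 of the
paper): every bijective linear map preserving the even and odd parts and the
superbracket is of the form `ψ⁺_{x,y,u,v}` or `ψ⁻_{x,y,u,v}` with `x, y ≠ 0` and
`x*y = u + v`. -/
theorem even_automorphism_classification {K : Type*} [RCLike K]
    (β : (Fin 4 → K) →ₗ[K] (Fin 4 → K) →ₗ[K] (Fin 4 → K))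
    (hβ : IsSuperBracket K β)
    (T : (Fin 4 → K) →ₗ[K] (Fin 4 → K))
    (hbij : Function.Bijective T)
    (heven : Submodule.map T (Submodule.span K {eA K, eB K}) = Submodule.span K {eA K, eB K})
    (hodd : Submodule.map T (Submodule.span K {eC K, eD K}) = Submodule.span K {eC K, eD K})
    (hbr : ∀ X Y : Fin 4 → K, T (β X Y) = β (T X) (T Y)) :
    (∃ x y u v : K, x ≠ 0 ∧ y ≠ 0 ∧ x*y = u + v ∧
      T (eA K) = u • eA K + (u - 1) • eB K ∧
      T (eB K) = v • eA K + (v + 1) • eB K ∧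
      T (eC K) = x • eC K ∧ T (eD K) = y • eD K) ∨
    (∃ x y u v : K, x ≠ 0 ∧ y ≠ 0 ∧ x*y = u + v ∧
      T (eA K) = u • eA K + (u + 1) • eB K ∧
      T (eB K) = v • eA K + (v - 1) • eB K ∧
      T (eC K) = x • eD K ∧ T (eD K) = y • eC K) := by
  obtain ⟨a, b, hA⟩ := exists_smul_add_smul_of_map_span_pair heven (z := eA K) (by simp)
  obtain ⟨c, d, hB⟩ := exists_smul_add_smul_of_map_span_pair heven (z := eB K) (by simp)
  obtain ⟨p, q, hC⟩ := exists_smul_add_smul_of_map_span_pair hodd (z := eC K) (by simp)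
  obtain ⟨r, s, hD⟩ := exists_smul_add_smul_of_map_span_pair hodd (z := eD K) (by simp)
  have hC_ne : ¬(p = 0 ∧ q = 0) := by
    rintro ⟨rfl, rfl⟩
    have h : eC K = 0 := hbij.1 (by simp [hC])
    simpa [eC] using congrFun h 2
  have hD_ne : ¬(r = 0 ∧ s = 0) := by
    rintro ⟨rfl, rfl⟩
    have h : eD K = 0 := hbij.1 (by simp [hD])
    simpa [eD] using congrFun h 3
  have hAC := hbr (eA K) (eC K)
  have hBC := hbr (eB K) (eC K)
  have hAD := hbr (eA K) (eD K)
  have hCD := hbr (eC K) (eD K)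
  rw [hA, hC, hβ.even_odd] at hAC
  rw [hB, hC, hβ.even_odd] at hBC
  rw [hA, hD, hβ.even_odd] at hAD
  rw [hC, hD, hβ.odd_odd] at hCD
  obtain ⟨-, -, -, -, bAC, -, bBC, -, bAD, -, -, -, bCD, -, -, -⟩ := hβ
  rw [bAC, hC] at hAC
  rw [bBC, map_neg, hC, neg_add, ← neg_smul, ← neg_smul] at hBC
  rw [bAD, map_neg, hD, neg_add, ← neg_smul, ← neg_smul] at hAD
  rw [bCD, map_add, hA, hB, add_add_add_comm, ← add_smul, ← add_smul] at hCD
  obtain ⟨hp, hq⟩ := smul_eC_add_smul_eD_inj hAC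
  obtain ⟨hp', hq'⟩ := smul_eC_add_smul_eD_inj hBC
  obtain ⟨hr, hs⟩ := smul_eC_add_smul_eD_inj hAD
  obtain ⟨hac, -⟩ := smul_eA_add_smul_eB_inj hCD
  by_cases hp0 : p = 0
  · right
    have hq0 : q ≠ 0 := fun h => hC_ne ⟨hp0, h⟩
    have hb : b = a + 1 := mul_right_cancel₀ hq0 (by linear_combination -hq)
    have hd : d = c - 1 := mul_right_cancel₀ hq0 (by linear_combination -hq')
    have hs0 : s = 0 := by
      rw [hb] at hs
      have h : 2 * s = 0 := by linear_combination -hs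
      simpa using h
    have hr0 : r ≠ 0 := fun h => hD_ne ⟨h, hs0⟩
    subst hp0 hs0 hb hd
    exact ⟨q, r, a, c, hq0, hr0, by linear_combination -hac, hA, hB,
      by simpa using hC, by simpa using hD⟩
  · left
    have hb : b = a - 1 := mul_right_cancel₀ hp0 (by linear_combination hp)
    have hd : d = c + 1 := mul_right_cancel₀ hp0 (by linear_combination hp')
    have hr0 : r = 0 := by
      rw [hb] at hr
      have h : 2 * r = 0 := by linear_combination -hr
      simpa using h
    have hq0 : q = 0 := by
      rw [hb] at hq
      have h : 2 * q = 0 := by linear_combination hq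
      simpa using h
    have hs0 : s ≠ 0 := fun h => hD_ne ⟨hr0, h⟩
    subst hq0 hr0 hb hd
    exact ⟨p, s, a, c, hp0, hs0, by linear_combination -hac, hA, hB,
      by simpa using hC, by simpa using hD⟩
end
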